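/- For a ring R the following are equivalent: (a) the left module _RR is weakly supplemented; (b) _RR has finite hollow dimension; (c) R is semilocal (R/Jac(R) is a semisimple ring); (d) the right module R_R has finite hollow dimension; (e) R_R is weakly supplemented. In this case hdim(_RR) = length(R/Jac(R)) = hdim(R_R). -/

import Mathlib

universe u v w

section Defs

variable (R : Type u) [Ring R] (M : Type v) [AddCommGroup M] [Module R M]

/-- `N` is a small (superfluous) submodule of `M`: `N + L = M` implies `L = M`. -/
def IsSmallSubmodule (N : Submodule R M) : Prop :=
  ∀ L : Submodule R M, N ⊔ L = ⊤ → L = ⊤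

/-- `N` is small in the submodule `T` (lattice-theoretic version). -/
def IsSmallInSubmodule (T N : Submodule R M) : Prop :=
  ∀ X : Submodule R M, X ≤ T → N ⊔ X = T → X = T

/-- `L` is a weak supplement of `N` in `M`. -/
def IsWeakSupplement (N L : Submodule R M) : Prop :=
  N ⊔ L = ⊤ ∧ IsSmallSubmodule R M (N ⊓ L)

/-- `M` is weakly supplemented. -/
def WeaklySupplemented : Prop :=
  ∀ N : Submodule R M, ∃ L : Submodule R M, IsWeakSupplement R M N L

/-- The radical of `M`: the intersection of all maximal submodules. -/
def moduleRad : Submodule R M :=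
  sInf {N : Submodule R M | IsCoatom N}

/-- `M` is a semilocal module: `M / Rad M` is semisimple. -/
def IsSemilocalModule : Prop :=
  IsSemisimpleModule R (M ⧸ moduleRad R M)

/-- `M` is hollow: nonzero and every proper submodule is small. -/
def IsHollowModule : Prop :=
  Nontrivial M ∧ ∀ N : Submodule R M, N ≠ ⊤ → IsSmallSubmodule R M N

/-- `N` is an essential submodule of `M`. -/
def IsEssentialSubmodule (N : Submodule R M) : Prop :=
  ∀ K : Submodule R M, K ≠ ⊥ → N ⊓ K ≠ ⊥

/-- A witness that `M` has hollow dimension `n`: a small-kernel epimorphism onto a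
direct sum of `n` hollow modules. -/
structure HollowDimWitness (n : ℕ) where
  H : Fin n → Type v
  [hAdd : ∀ i, AddCommGroup (H i)]
  [hMod : ∀ i, Module R (H i)]
  g : M →ₗ[R] ∀ i, H i
  surj : Function.Surjective g
  hollow : ∀ i, IsHollowModule R (H i)
  small : IsSmallSubmodule R M (LinearMap.ker g)

/-- `M` has finite hollow dimension. -/
def HasFiniteHollowDim : Prop := ∃ n : ℕ, Nonempty (HollowDimWitness R M n)

/-- The composition length of `M` is `n`. -/
def ModuleLengthIs (n : ℕ) : Prop :=
  ∃ s : CompositionSeries (Submodule R M), s.head = ⊥ ∧ s.last = ⊤ ∧ s.length = n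

/-- A family of proper submodules is coindependent. -/
def Coindependent {ι : Type w} (K : ι → Submodule R M) : Prop :=
  (∀ i, K i ≠ ⊤) ∧
    ∀ (i : ι) (J : Finset ι), i ∉ J → K i ⊔ (⨅ j ∈ J, K j) = ⊤

end Defs


section Helpers

open Module

variable {R : Type u} [Ring R] {M : Type v} [AddCommGroup M] [Module R M]

theorem hd_small_le_jacobson {N : Submodule R M} (h : IsSmallSubmodule R M N) :
    N ≤ jacobson R M := by
  refine le_sInf fun K (hK : IsCoatom K) => ?_
  by_contra hN
  have : K < N ⊔ K := lt_of_le_of_ne le_sup_right fun e => hN (e ▸ le_sup_left)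
  exact hK.1 (h K (hK.2 _ this))

theorem hd_small_of_le_jacobson [Module.Finite R M] {N : Submodule R M}
    (h : N ≤ jacobson R M) : IsSmallSubmodule R M N := by
  intro L hL
  by_contra hne
  obtain ⟨K, hK, hLK⟩ := (eq_top_or_exists_le_coatom L).resolve_left hne
  have h1 : N ≤ K := h.trans (sInf_le hK)
  exact hK.1 (top_le_iff.mp (hL ▸ sup_le h1 hLK))

theorem hd_ws_iff [Module.Finite R M] :
    WeaklySupplemented R M ↔ IsSemilocalModule R M := by
  change _ ↔ IsSemisimpleModule R (M ⧸ jacobson R M)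
  rw [isSemisimpleModule_iff, (Submodule.comapMkQRelIso (jacobson R M)).complementedLattice_iff]
  set J := jacobson R M with hJ
  constructor
  · intro h
    refine ⟨fun ⟨N, hN⟩ => ?_⟩
    have hN' : J ≤ N := hN
    obtain ⟨L, hL, hs⟩ := h N
    refine ⟨⟨L ⊔ J, (le_sup_right : J ≤ L ⊔ J)⟩, ?_, ?_⟩
    · rw [disjoint_iff]
      apply Subtype.ext
      change N ⊓ (L ⊔ J) = J
      rw [inf_comm, sup_comm, sup_inf_assoc_of_le L hN', inf_comm]
      exact sup_eq_left.mpr (hd_small_le_jacobson hs)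
    · rw [codisjoint_iff]
      apply Subtype.ext
      change N ⊔ (L ⊔ J) = ⊤
      rw [← sup_assoc, hL, top_sup_eq]
  · intro h N
    obtain ⟨⟨L, hL⟩, hd, hc⟩ := h.exists_isCompl ⟨N ⊔ J, (le_sup_right : J ≤ N ⊔ J)⟩
    rw [disjoint_iff] at hd
    rw [codisjoint_iff] at hc
    have hd' : (N ⊔ J) ⊓ L = J := congrArg Subtype.val hd
    have hc' : (N ⊔ J) ⊔ L = ⊤ := congrArg Subtype.val hc
    have hL' : J ≤ L := hL
    refine ⟨L, ?_, hd_small_of_le_jacobson ?_⟩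
    · rwa [sup_assoc, sup_eq_right.mpr hL'] at hc'
    · exact (inf_le_inf_right L le_sup_left).trans hd'.le

theorem hd_hollow_simple [Module.Finite R M] (h : IsHollowModule R M) :
    IsSimpleModule R (M ⧸ jacobson R M) := by
  have := h.1
  rw [isSimpleModule_iff_isCoatom]
  refine ⟨(jacobson_lt_top R M).ne, fun N hN => ?_⟩
  by_contra hne
  exact hN.not_ge (hd_small_le_jacobson (h.2 N hne))

theorem hd_simple_hollow [IsSimpleModule R M] : IsHollowModule R M := by
  refine ⟨IsSimpleModule.nontrivial R M, fun N hN L hL => ?_⟩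
  rcases eq_bot_or_eq_top N with h | h
  · rwa [h, bot_sup_eq] at hL
  · exact absurd h hN

theorem hd_jacobson_pi {n : ℕ} (H : Fin n → Type v) [∀ i, AddCommGroup (H i)]
    [∀ i, Module R (H i)] :
    jacobson R (Π i, H i) = Submodule.pi Set.univ (fun i => jacobson R (H i)) := by
  refine le_antisymm (jacobson_pi_le R H) fun x hx => ?_
  rw [← Finset.univ_sum_single x]
  refine Submodule.sum_mem _ fun i _ => ?_
  exact map_jacobson_le (LinearMap.single R H i) ⟨x i, hx i (Set.mem_univ i), rfl⟩

theorem hd_of_witness [Module.Finite R M] {n : ℕ} (w : HollowDimWitness R M n) :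
    IsSemisimpleModule R (M ⧸ jacobson R M) ∧ Module.length R (M ⧸ jacobson R M) = n := by
  obtain ⟨H, g, surj, hollow, small⟩ := w
  have hfin : ∀ i, Module.Finite R (H i) := fun i =>
    Module.Finite.of_surjective ((LinearMap.proj (R := R) (φ := H) i).comp g)
      ((LinearMap.proj_surjective (R := R) (φ := H) i).comp surj)
  have hs : ∀ i, IsSimpleModule R (H i ⧸ jacobson R (H i)) := fun i => hd_hollow_simple (hollow i)
  let p : (Π i, H i) →ₗ[R] Π i, (H i ⧸ jacobson R (H i)) :=
    LinearMap.pi fun i => (jacobson R (H i)).mkQ.comp (LinearMap.proj i)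
  have hp : Function.Surjective p := by
    intro y
    choose x hx using fun i => (jacobson R (H i)).mkQ_surjective (y i)
    exact ⟨x, funext hx⟩
  have hkp : LinearMap.ker p = jacobson R (Π i, H i) := by
    rw [hd_jacobson_pi]
    ext x
    simp [p, LinearMap.ker_pi, Submodule.mem_pi]
  have hk : LinearMap.ker (p.comp g) = jacobson R M := by
    rw [LinearMap.ker_comp, hkp]
    exact comap_jacobson_of_ker_le surj (hd_small_le_jacobson small)
  have e : (M ⧸ jacobson R M) ≃ₗ[R] Π i, (H i ⧸ jacobson R (H i)) :=
    (Submodule.quotEquivOfEq _ _ hk.symm).trans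
      ((p.comp g).quotKerEquivOfSurjective (hp.comp surj))
  refine ⟨.congr e, ?_⟩
  rw [e.length_eq, Module.length_pi_of_fintype]
  simp [Module.length_eq_one]

theorem hd_exists_witness [Module.Finite R M] (h : IsSemisimpleModule R (M ⧸ jacobson R M)) :
    ∃ n, Nonempty (HollowDimWitness R M n) := by
  obtain ⟨n, T, e, hT⟩ := IsSemisimpleModule.exists_linearEquiv_fin_dfinsupp R (M ⧸ jacobson R M)
  let e' : (M ⧸ jacobson R M) ≃ₗ[R] Π i, T i := e.trans DFinsupp.linearEquivFunOnFintype
  refine ⟨n, ⟨⟨fun i => T i, e'.toLinearMap.comp (jacobson R M).mkQ, ?_,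
    fun i => hd_simple_hollow, ?_⟩⟩⟩
  · exact e'.surjective.comp (Submodule.mkQ_surjective _)
  · apply hd_small_of_le_jacobson
    rw [LinearEquiv.ker_comp, Submodule.ker_mkQ]

theorem hd_witness_iff [Module.Finite R M] (n : ℕ) : Nonempty (HollowDimWitness R M n) ↔
    IsSemisimpleModule R (M ⧸ jacobson R M) ∧ Module.length R (M ⧸ jacobson R M) = n := by
  refine ⟨fun ⟨w⟩ => hd_of_witness w, fun ⟨h, hn⟩ => ?_⟩
  obtain ⟨m, ⟨w⟩⟩ := hd_exists_witness h
  have := (hd_of_witness w).2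
  rw [hn] at this
  obtain rfl : n = m := by exact_mod_cast this
  exact ⟨w⟩

theorem hd_finite_iff [Module.Finite R M] :
    HasFiniteHollowDim R M ↔ IsSemilocalModule R M :=
  ⟨fun ⟨_, ⟨w⟩⟩ => (hd_of_witness w).1, fun h => hd_exists_witness h⟩

theorem hd_length_is {n : ℕ} (h : Module.length R M = n) : ModuleLengthIs R M n := by
  have hf : IsFiniteLength R M := by
    rw [← Module.length_ne_top_iff, h]
    exact ENat.natCast_ne_top n
  obtain ⟨s, h1, h2⟩ := isFiniteLength_iff_exists_compositionSeries.mp hf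
  refine ⟨s, h1, h2, ?_⟩
  have := Module.length_compositionSeries s h1 h2
  rw [h] at this
  exact_mod_cast this

theorem hd_length_of_bijective {S : Type*} [Ring S] {N : Type*} [AddCommGroup N] [Module S N]
    {σ : R →+* S} [RingHomSurjective σ] (l : M →ₛₗ[σ] N) (hl : Function.Bijective l) :
    Module.length R M = Module.length S N := by
  apply WithBot.coe_injective
  rw [Module.coe_length, Module.coe_length,
    Order.krullDim_eq_of_orderIso (Submodule.orderIsoMapComapOfBijective l hl)]

theorem hd_of_surjective {S : Type*} [Ring S] {N : Type*} [AddCommGroup N] [Module S N]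
    {σ : R →+* S} [RingHomSurjective σ] (l : M →ₛₗ[σ] N) (hl : Function.Surjective l)
    (K : Submodule R M) (hK : ∀ x, x ∈ K ↔ l x = 0) :
    (IsSemisimpleModule R (M ⧸ K) ↔ IsSemisimpleModule S N) ∧
      Module.length R (M ⧸ K) = Module.length S N := by
  have hle : K ≤ LinearMap.ker l := fun x hx => (hK x).mp hx
  have hb : Function.Bijective (K.liftQ l hle) := by
    constructor
    · rw [← LinearMap.ker_eq_bot]
      apply Submodule.ker_liftQ_eq_bot
      exact fun x hx => (hK x).mpr hx
    · intro y
      obtain ⟨x, rfl⟩ := hl y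
      exact ⟨K.mkQ x, rfl⟩
  exact ⟨LinearMap.isSemisimpleModule_iff_of_bijective _ hb, hd_length_of_bijective _ hb⟩

theorem hd_jacobson_eq (A : Type*) [Ring A] : Ring.jacobson A = Ideal.jacobson (⊥ : Ideal A) := by
  rw [Ring.jacobson_eq_sInf_isMaximal, Ideal.jacobson]
  simp

open MulOpposite in
theorem hd_op_mem {A : Type*} [Ring A] {x : A} (hx : x ∈ Ring.jacobson A) :
    op x ∈ Ring.jacobson Aᵐᵒᵖ := by
  rw [hd_jacobson_eq, Ideal.mem_jacobson_iff]
  intro y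
  have hxy : x * y.unop ∈ Ring.jacobson A := Ideal.mul_mem_right _ _ hx
  have key : ∀ a ∈ Ring.jacobson A, ∃ s, s * (a + 1) = 1 := by
    intro a ha
    rw [hd_jacobson_eq] at ha
    obtain ⟨s, hs⟩ := Ideal.exists_mul_add_sub_mem_of_mem_jacobson a ha
    exact ⟨s, sub_eq_zero.mp hs⟩
  obtain ⟨s, hs⟩ := key _ hxy
  have hs1 : -(s * (x * y.unop)) ∈ Ring.jacobson A :=
    neg_mem (Ideal.mul_mem_left _ _ hxy)
  obtain ⟨t, ht⟩ := key _ hs1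
  have e : -(s * (x * y.unop)) + 1 = s := by
    rw [← hs]; noncomm_ring
  rw [e] at ht
  have h2 : t = x * y.unop + 1 := by
    calc t = t * (s * (x * y.unop + 1)) := by rw [hs, mul_one]
      _ = x * y.unop + 1 := by rw [← mul_assoc, ht, one_mul]
  rw [h2] at ht
  refine ⟨op s, ?_⟩
  rw [Ideal.mem_bot, sub_eq_zero]
  apply unop_injective
  simp only [unop_add, unop_mul, unop_op, unop_one]
  rw [← ht]; noncomm_ring

open MulOpposite in
theorem hd_op_mem_iff {A : Type*} [Ring A] {x : A} :
    op x ∈ Ring.jacobson Aᵐᵒᵖ ↔ x ∈ Ring.jacobson A := by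
  refine ⟨fun h => ?_, hd_op_mem⟩
  have h1 := hd_op_mem h
  let σ : Aᵐᵒᵖᵐᵒᵖ →+* A := ((RingEquiv.opOp A).symm : Aᵐᵒᵖᵐᵒᵖ ≃+* A)
  have : RingHomSurjective σ := ⟨(RingEquiv.opOp A).symm.surjective⟩
  exact Ring.le_comap_jacobson σ h1

open MulOpposite in
theorem hd_mem_right {A : Type*} [Ring A] {x : A} :
    x ∈ jacobson Aᵐᵒᵖ A ↔ x ∈ Ring.jacobson A := by
  rw [← hd_op_mem_iff]
  let l : A →ₗ[Aᵐᵒᵖ] Aᵐᵒᵖ :=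
    { toFun := op, map_add' := fun _ _ => rfl, map_smul' := fun _ _ => rfl }
  have hl : Function.Bijective l := ⟨op_injective, op_surjective⟩
  rw [← comap_jacobson_of_bijective hl]
  rfl

open MulOpposite in
/-- The right annihilator of a left ideal, as a left ideal of the opposite ring. -/
def hdAnn {A : Type*} [Ring A] (L : Ideal A) : Ideal Aᵐᵒᵖ where
  carrier := {x | ∀ a ∈ L, a * x.unop = 0}
  add_mem' := fun {x y} hx hy a ha => by simp [mul_add, hx a ha, hy a ha]
  zero_mem' := fun a _ => by simp
  smul_mem' := fun c x hx a ha => by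
    simp [← mul_assoc, hx a ha]

open MulOpposite in
theorem hd_length_le (A : Type*) [Ring A] [IsSemisimpleRing A] :
    Module.length A A ≤ Module.length Aᵐᵒᵖ Aᵐᵒᵖ := by
  apply WithBot.coe_le_coe.mp
  rw [Module.coe_length, Module.coe_length, ← Order.krullDim_orderDual (α := Submodule Aᵐᵒᵖ Aᵐᵒᵖ)]
  have anti : ∀ L L' : Ideal A, L ≤ L' → hdAnn L' ≤ hdAnn L :=
    fun L L' h x hx a ha => hx a (h ha)
  have refl : ∀ L L' : Ideal A, hdAnn L' ≤ hdAnn L → L ≤ L' := by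
    intro L L' h a ha
    obtain ⟨C, hC⟩ := exists_isCompl L'
    have h1 : (1 : A) ∈ L' ⊔ C := by rw [hC.sup_eq_top]; trivial
    obtain ⟨e, he, f, hf, hef⟩ := Submodule.mem_sup.mp h1
    have hfm : op f ∈ hdAnn L' := by
      intro b hb
      change b * f = 0
      have h3 : b * f = b - b * e := by
        rw [eq_sub_iff_add_eq, ← mul_add, add_comm f e, hef, mul_one]
      have h4 : b * f ∈ L' ⊓ C :=
        ⟨h3 ▸ sub_mem hb (L'.mul_mem_left b he), C.mul_mem_left b hf⟩
      rw [hC.inf_eq_bot] at h4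
      exact h4
    have h5 : a * f = 0 := h hfm a ha
    have h6 : a = a * e := by
      calc a = a * (e + f) := by rw [hef, mul_one]
        _ = a * e := by rw [mul_add, h5, add_zero]
    rw [h6]
    exact L'.mul_mem_left a he
  refine Order.krullDim_le_of_strictMono
    (fun L : Submodule A A => OrderDual.toDual (hdAnn L)) fun L L' h => ?_
  rw [OrderDual.toDual_lt_toDual]
  exact lt_of_le_not_ge (anti _ _ h.le) fun h' => h.not_ge (refl _ _ h')

theorem hd_length_op (A : Type*) [Ring A] [IsSemisimpleRing A] :
    Module.length Aᵐᵒᵖ Aᵐᵒᵖ = Module.length A A := by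
  refine le_antisymm ((hd_length_le Aᵐᵒᵖ).trans_eq ?_) (hd_length_le A)
  let σ : Aᵐᵒᵖᵐᵒᵖ →+* A := ((RingEquiv.opOp A).symm : Aᵐᵒᵖᵐᵒᵖ ≃+* A)
  have : RingHomSurjective σ := ⟨(RingEquiv.opOp A).symm.surjective⟩
  exact hd_length_of_bijective σ.toSemilinearMap (RingEquiv.opOp A).symm.bijective

open MulOpposite in
theorem hd_symm (A : Type*) [Ring A] :
    (IsSemisimpleModule A (A ⧸ jacobson A A) ↔
      IsSemisimpleModule Aᵐᵒᵖ (A ⧸ jacobson Aᵐᵒᵖ A)) ∧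
    (IsSemisimpleModule A (A ⧸ jacobson A A) →
      Module.length A (A ⧸ jacobson A A) = Module.length Aᵐᵒᵖ (A ⧸ jacobson Aᵐᵒᵖ A)) := by
  let S := A ⧸ Ring.jacobson A
  let σ : A →+* S := Ideal.Quotient.mk (Ring.jacobson A)
  have hσ : Function.Surjective σ := Ideal.Quotient.mk_surjective
  have : RingHomSurjective σ := ⟨hσ⟩
  let τ : Aᵐᵒᵖ →+* Sᵐᵒᵖ := RingHom.op σ
  have hτ : Function.Surjective τ := fun y => by
    obtain ⟨x, hx⟩ := hσ y.unop
    exact ⟨op x, congrArg op hx⟩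
  have : RingHomSurjective τ := ⟨hτ⟩
  let l : A →ₛₗ[τ] Sᵐᵒᵖ :=
    { toFun := fun x => op (σ x)
      map_add' := fun x y => by simp
      map_smul' := fun c x => by
        change op (σ (x * c.unop)) = op (σ c.unop) * op (σ x)
        rw [map_mul, op_mul] }
  have h1 := hd_of_surjective σ.toSemilinearMap hσ (jacobson A A)
    (fun x => Ideal.Quotient.eq_zero_iff_mem.symm)
  have h2 := hd_of_surjective l (fun y => by
      obtain ⟨x, hx⟩ := hσ y.unop
      exact ⟨x, congrArg op hx⟩) (jacobson Aᵐᵒᵖ A) (fun x => by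
      rw [hd_mem_right]
      change _ ↔ op (σ x) = 0
      rw [op_eq_zero_iff]
      exact Ideal.Quotient.eq_zero_iff_mem.symm)
  refine ⟨?_, fun h => ?_⟩
  · rw [h1.1, h2.1]
    exact (isSemisimpleRing_mulOpposite_iff (R := S)).symm
  · have : IsSemisimpleRing S := h1.1.mp h
    rw [h1.2, h2.2, hd_length_op]

end Helpers

/-- For a ring `R`: `_RR` weakly supplemented ↔ `_RR` has finite
hollow dimension ↔ `R` is semilocal ↔ `R_R` has finite hollow dimension ↔ `R_R`
weakly supplemented; and then `hdim _RR = length (R/Jac R) = hdim R_R`. -/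
theorem semilocal_ring_weaklySupplemented_characterization
    (R : Type u) [Ring R] :
    (WeaklySupplemented R R ↔ HasFiniteHollowDim R R) ∧
    (HasFiniteHollowDim R R ↔ IsSemilocalModule R R) ∧
    (IsSemilocalModule R R ↔ HasFiniteHollowDim Rᵐᵒᵖ R) ∧
    (HasFiniteHollowDim Rᵐᵒᵖ R ↔ WeaklySupplemented Rᵐᵒᵖ R) ∧
    (IsSemilocalModule R R →
      ∀ n : ℕ,
        (Nonempty (HollowDimWitness R R n) →
          ModuleLengthIs R (R ⧸ moduleRad R R) n) ∧
        (Nonempty (HollowDimWitness R R n) ↔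
          Nonempty (HollowDimWitness Rᵐᵒᵖ R n))) := by
  have : Module.Finite Rᵐᵒᵖ R := Module.Finite.of_surjective
    ({ toFun := MulOpposite.unop, map_add' := fun _ _ => rfl, map_smul' := fun _ _ => rfl } :
      Rᵐᵒᵖ →ₗ[Rᵐᵒᵖ] R) MulOpposite.unop_surjective
  have hs := hd_symm R
  refine ⟨hd_ws_iff.trans hd_finite_iff.symm, hd_finite_iff, hs.1.trans hd_finite_iff.symm,
    hd_finite_iff.trans hd_ws_iff.symm, fun h n => ⟨fun ⟨w⟩ => hd_length_is (hd_of_witness w).2, ?_⟩⟩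
  rw [hd_witness_iff, hd_witness_iff, ← hs.1, hs.2 h]
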